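/- Let G = (V, E) be a digraph, let H₁ be the undirected complement of G (the complement of U(G)), and let H₂ be the undirected complement of the transitive closure G* of G (the complement of U(G*)). Then every edge of H₂ is an edge of H₁, and for any two edges (a,b), (c,d) of H₂: if (a,b) Γ* (c,d) holds with respect to H₂, then (a,b) Γ* (c,d) holds with respect to H₁. -/

import Mathlib

namespace PaperMD

variable {V : Type*}

/-- `M` is a module of the digraph with edge relation `E`: it is nonempty and
every outside vertex relates uniformly to all of `M`. -/
def IsModule (E : V → V → Prop) (M : Set V) : Prop :=
  M.Nonempty ∧ ∀ x ∉ M, ∀ a ∈ M, ∀ b ∈ M, (E x a ↔ E x b) ∧ (E a x ↔ E b x)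

/-- Two vertex sets overlap: they intersect, but neither contains the other. -/
def Overlap (A B : Set V) : Prop :=
  (A ∩ B).Nonempty ∧ ¬A ⊆ B ∧ ¬B ⊆ A

/-- A strong module: a module overlapping no module. -/
def IsStrongModule (E : V → V → Prop) (M : Set V) : Prop :=
  IsModule E M ∧ ∀ N : Set V, IsModule E N → ¬Overlap M N

/-- `a` and `b` are quotient-distinct in the module `M`: they are distinct members of `M`
and no strong module properly contained in `M` contains both. -/
def QuotDistinct (E : V → V → Prop) (M : Set V) (a b : V) : Prop :=
  a ∈ M ∧ b ∈ M ∧ a ≠ b ∧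
    ∀ S : Set V, IsStrongModule E S → S ⊂ M → ¬(a ∈ S ∧ b ∈ S)

/-- `M` is a series module: every quotient-distinct pair is joined by edges both ways. -/
def IsSeries (E : V → V → Prop) (M : Set V) : Prop :=
  IsModule E M ∧ ∀ a b, QuotDistinct E M a b → E a b ∧ E b a

/-- `M` is a parallel module: no edges between quotient-distinct pairs. -/
def IsParallel (E : V → V → Prop) (M : Set V) : Prop :=
  IsModule E M ∧ ∀ a b, QuotDistinct E M a b → ¬E a b ∧ ¬E b a

/-- `M` is an ordered module: quotient-distinct pairs are joined by exactly one directed edge,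
and these edges are transitive on quotient-distinct triples. -/
def IsOrdered (E : V → V → Prop) (M : Set V) : Prop :=
  IsModule E M ∧
    (∀ a b, QuotDistinct E M a b → Xor' (E a b) (E b a)) ∧
    (∀ a b c, QuotDistinct E M a b → QuotDistinct E M b c → QuotDistinct E M a c →
      E a b → E b c → E a c)

/-- Undirected closure `U(G)`: edge set `E ∪ E⁻¹`. -/
def UClos (E : V → V → Prop) : V → V → Prop := fun a b => E a b ∨ E b a

/-- Transitive closure `G*`: `a ≠ b` and a nonempty directed path from `a` to `b`. -/
def TClos (E : V → V → Prop) : V → V → Prop :=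
  fun a b => a ≠ b ∧ Relation.TransGen E a b

/-- `G` is acyclic: no nonempty directed path leads from a vertex back to itself. -/
def Acyclic (E : V → V → Prop) : Prop := ∀ a, ¬Relation.TransGen E a a

/-- `G` is transitive: `(a,b), (b,c) ∈ E` with `a ≠ c` implies `(a,c) ∈ E`. -/
def TransRel (E : V → V → Prop) : Prop := ∀ a b c, E a b → E b c → a ≠ c → E a c

/-- `G` is transitively reduced: no edge `(a,b)` admits a directed path from `a` to `b`
of length at least 2. -/
def TransReduced (E : V → V → Prop) : Prop :=
  ∀ a b, E a b → ¬∃ c, E a c ∧ Relation.TransGen E c b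

/-- Undirected complement of a digraph: all pairs `(a,b)`, `a ≠ b`, adjacent in
neither direction. -/
def UComp (E : V → V → Prop) : V → V → Prop :=
  fun a b => a ≠ b ∧ ¬E a b ∧ ¬E b a

/-- `seq(a,b)`: `(a,b) ∈ E`, `b` is the only successor of `a`, `a` the only
predecessor of `b`. -/
def SeqR (E : V → V → Prop) (a b : V) : Prop :=
  a ≠ b ∧ E a b ∧ (∀ c, E a c → c = b) ∧ (∀ c, E c b → c = a)

/-- `par(a,b)`: distinct vertices with identical predecessor and successor sets. -/
def ParR (E : V → V → Prop) (a b : V) : Prop :=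
  a ≠ b ∧ ∀ c, (E c a ↔ E c b) ∧ (E a c ↔ E b c)

/-- Mutual reachability (reflexive): `a = b`, or nonempty directed paths both ways. -/
def MutReach (E : V → V → Prop) (a b : V) : Prop :=
  a = b ∨ (Relation.TransGen E a b ∧ Relation.TransGen E b a)

/-- The forcing relation `Γ` between edges of an undirected graph `D`. -/
def Forces (D : V → V → Prop) (p q : V × V) : Prop :=
  D p.1 p.2 ∧ D q.1 q.2 ∧
    ((p.1 = q.1 ∧ p.2 ≠ q.2 ∧ ¬D p.2 q.2) ∨ (p.2 = q.2 ∧ p.1 ≠ q.1 ∧ ¬D p.1 q.1))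

/-- `F` is an orientation of the undirected graph `D`: `F ⊆ D` and for each edge of `D`
exactly one direction lies in `F`. -/
def IsOrientation (D F : V → V → Prop) : Prop :=
  (∀ a b, F a b → D a b) ∧ ∀ a b, D a b → Xor' (F a b) (F b a)

/-- A transitive orientation of the undirected graph `D`. -/
def IsTransOrientation (D F : V → V → Prop) : Prop :=
  IsOrientation D F ∧ ∀ a b c, F a b → F b c → a ≠ c → F a c

theorem UComp.symm {E : V → V → Prop} {a b : V} (h : UComp E a b) : UComp E b a :=
  ⟨h.1.symm, h.2.2, h.2.1⟩

theorem Forces.symm {E : V → V → Prop} {p q : V × V} (h : Forces (UComp E) p q) :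
    Forces (UComp E) q p := by
  obtain ⟨hp, hq, ⟨h1, h2, h3⟩ | ⟨h1, h2, h3⟩⟩ := h
  · exact ⟨hq, hp, .inl ⟨h1.symm, h2.symm, fun h => h3 h.symm⟩⟩
  · exact ⟨hq, hp, .inr ⟨h1.symm, h2.symm, fun h => h3 h.symm⟩⟩

theorem Forces.swap {E : V → V → Prop} {p q : V × V} (h : Forces (UComp E) p q) :
    Forces (UComp E) p.swap q.swap :=
  ⟨h.1.symm, h.2.1.symm, h.2.2.symm⟩

theorem uComp_tClos_iff {E : V → V → Prop} {a b : V} :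
    UComp (TClos E) a b ↔ ¬Relation.ReflTransGen E a b ∧ ¬Relation.ReflTransGen E b a := by
  simp only [UComp, TClos, Relation.reflTransGen_iff_eq_or_transGen]
  grind

theorem UComp.of_tClos {E : V → V → Prop} {a b : V} (h : UComp (TClos E) a b) : UComp E a b :=
  ⟨h.1, fun e => h.2.1 ⟨h.1, .single e⟩, fun e => h.2.2 ⟨h.1.symm, .single e⟩⟩

/-- A directed path whose start does not reach `a` and whose end is not reached from `a` can be
followed by forcing steps between edges at `a` of the undirected complement. -/
theorem forces_of_path {E : V → V → Prop} (hirr : ∀ x, ¬E x x) {a b d : V}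
    (hbd : Relation.ReflTransGen E b d) (hba : ¬Relation.ReflTransGen E b a)
    (had : ¬Relation.ReflTransGen E a d) :
    Relation.ReflTransGen (Forces (UComp E)) (a, b) (a, d) := by
  have key : ∀ x, Relation.ReflTransGen E b x → ¬Relation.ReflTransGen E a x → UComp E a x := by
    intro x hbx hax
    refine ⟨?_, fun e => hax (.single e), fun e => hba (hbx.tail e)⟩
    rintro rfl
    exact hax .refl
  induction hbd with
  | refl => exact .refl
  | @tail c d hbc hcd ih =>
    have hac : ¬Relation.ReflTransGen E a c := fun h => had (h.tail hcd)
    refine (ih hac).tail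
      ⟨key c hbc hac, key d (hbc.tail hcd) had, .inl ⟨rfl, ?_, fun h => h.2.1 hcd⟩⟩
    rintro rfl
    exact hirr c hcd

theorem forces_of_uComp_tClos {E : V → V → Prop} (hirr : ∀ x, ¬E x x) {a b d : V}
    (hab : UComp (TClos E) a b) (had : UComp (TClos E) a d) (hbd : ¬UComp (TClos E) b d) :
    Relation.ReflTransGen (Forces (UComp E)) (a, b) (a, d) := by
  rw [uComp_tClos_iff] at hab had hbd
  by_cases h : Relation.ReflTransGen E b d
  · exact forces_of_path hirr h hab.2 had.1
  · have hdb : Relation.ReflTransGen E d b := by tauto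
    have hsymm : Std.Symm (Forces (UComp E)) := ⟨fun _ _ => Forces.symm⟩
    exact symm (forces_of_path hirr hdb had.2 hab.1)

/-- every edge of the undirected complement of `G*` is an edge of the
undirected complement of `G`, and indirect forcing (`Γ*`) in the former implies
indirect forcing in the latter. -/
theorem stmt11 {V : Type*} [Fintype V] (E : V → V → Prop) (hirr : Irreflexive E) :
    (∀ a b : V, UComp (TClos E) a b → UComp E a b) ∧
      ∀ p q : V × V, UComp (TClos E) p.1 p.2 → UComp (TClos E) q.1 q.2 →
        Relation.ReflTransGen (Forces (UComp (TClos E))) p q →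
        Relation.ReflTransGen (Forces (UComp E)) p q := by
  refine ⟨fun a b h => h.of_tClos, ?_⟩
  rintro p q - - hpq
  induction hpq with
  | refl => exact .refl
  | @tail x y _ hxy ih =>
    refine ih.trans ?_
    obtain ⟨a, b⟩ := x
    obtain ⟨c, d⟩ := y
    obtain ⟨hp, hq, ⟨rfl, -, h⟩ | ⟨rfl, -, h⟩⟩ := hxy
    · exact forces_of_uComp_tClos hirr hp hq h
    · exact (forces_of_uComp_tClos hirr hp.symm hq.symm h).lift Prod.swap fun _ _ => Forces.swap

end PaperMD
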